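/- Let 𝕌 = {T₀, T₁, T₂, …} be a countable set of Silver trees and let f : 2^ω × ω^ω → 2^ω be a Borel map. Then there exists a countable set 𝕌' = {S₀, S₁, S₂, …} of Silver trees such that S_n ⊆ T_n for all n < ω and f is normalized on S₀ for 𝕌'. -/

import Mathlib

open Set

/-- The word `u₀⌢i₀⌢u₁⌢i₁⌢…⌢u_n⌢i_n` built from the defining tuples `u`
and the choice of bits `i`. -/
def silverWord (u : ℕ → List Bool) (i : ℕ → Bool) : ℕ → List Bool
  | 0 => u 0 ++ [i 0]
  | n + 1 => silverWord u i n ++ (u (n + 1) ++ [i (n + 1)])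

/-- `T ⊆ 2^{<ω}` is the Silver tree with defining tuples `u`: it consists of all
tuples `u₀⌢i₀⌢…⌢u_n⌢i_n` together with all their initial segments. -/
def IsSilver (T : Set (List Bool)) (u : ℕ → List Bool) : Prop :=
  T = { s | ∃ (n : ℕ) (i : ℕ → Bool), s <+: silverWord u i n }

/-- `T` is a Silver tree. -/
def SilverTree (T : Set (List Bool)) : Prop :=
  ∃ u, IsSilver T u

/-- The portion `T↾u = {s ∈ T : u ⊆ s or s ⊆ u}`. -/
def portion (T : Set (List Bool)) (u : List Bool) : Set (List Bool) :=
  { s ∈ T | u <+: s ∨ s <+: u }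

/-- The shift `σ⊕v` of a tuple `v` by a tuple `σ` (coordinatewise mod-2 sum,
with `σ` padded by `0` or truncated to the length of `v`). -/
def shiftT (σ v : List Bool) : List Bool :=
  List.ofFn fun i : Fin v.length => xor (v.get i) (σ.getD i.1 false)

/-- The shift `σ⊕T` of a set of tuples. -/
def shiftTree (σ : List Bool) (T : Set (List Bool)) : Set (List Bool) :=
  shiftT σ '' T

/-- The shift `σ⊕a` of a point of Cantor space. -/
def shiftR (σ : List Bool) (a : ℕ → Bool) : ℕ → Bool :=
  fun i => xor (a i) (σ.getD i false)

/-- The restriction `a↾n ∈ 2^{<ω}` of `a ∈ 2^ω`. -/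
def restrictReal (a : ℕ → Bool) (n : ℕ) : List Bool :=
  List.ofFn fun i : Fin n => a i.1

/-- `[T]`, the set of branches of `T`. -/
def branches (T : Set (List Bool)) : Set (ℕ → Bool) :=
  { a | ∀ n, restrictReal a n ∈ T }

/-- The splitting levels `oi_T(n) = |u₀|+1+…+|u_{n-1}|+1+|u_n|` computed
from the defining tuples `u`. -/
def oi (u : ℕ → List Bool) (n : ℕ) : ℕ :=
  (∑ k ∈ Finset.range (n + 1), (u k).length) + n

/-- `S ⊑ₙ T` : `S ⊆ T` and the first `n` splitting levels agree. -/
def RefinesN (S T : Set (List Bool)) (n : ℕ) : Prop :=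
  S ⊆ T ∧ ∀ uS uT : ℕ → List Bool, IsSilver S uS → IsSilver T uT →
    ∀ k < n, oi uS k = oi uT k

/-- `S` is clopen in `T` : `S` is a finite union of portions of `T`. -/
def ClopenIn (S T : Set (List Bool)) : Prop :=
  ∃ F : Finset (List Bool), ↑F ⊆ T ∧ S = ⋃ u ∈ F, portion T u

/-- The Baire interval `B_v = {x ∈ ω^ω : v ⊂ x}`. -/
def baire (v : List ℕ) : Set (ℕ → ℕ) :=
  { x | ∀ i : Fin v.length, x i.1 = v.get i }

/-- `s ∈ 2^{<ω}` is an initial segment of `a ∈ 2^ω`. -/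
def prefixOfReal (s : List Bool) (a : ℕ → Bool) : Prop :=
  ∀ i : Fin s.length, a i.1 = s.get i

/-- `f` is normalized on the Silver tree `T` for the collection `𝕌`. -/
def Normalized (f : (ℕ → Bool) × (ℕ → ℕ) → (ℕ → Bool))
    (T : Set (List Bool)) (𝕌 : Set (Set (List Bool))) : Prop :=
  ∃ X : Set (ℕ → ℕ), IsGδ X ∧ Dense X ∧ ContinuousOn f (branches T ×ˢ X) ∧
    ((∃ (v : List ℕ) (σ : List Bool),
        ∀ a ∈ branches T, ∀ x ∈ baire v ∩ X, f (a, x) = shiftR σ a) ∨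
     (∀ a ∈ branches T, ∀ x ∈ X, ∀ σ : List Bool, ∀ S ∈ 𝕌,
        f (a, x) ∉ shiftR σ '' branches S))

/-- The points of Cantor space which agree with `c` outside of `A`. -/
def freeCube (A : Set ℕ) (c : ℕ → Bool) : Set (ℕ → Bool) :=
  { a | ∀ i ∉ A, a i = c i }

/-- The tree of all finite initial segments of elements of `K`. -/
def initialSegments (K : Set (ℕ → Bool)) : Set (List Bool) :=
  { s | ∃ a ∈ K, s = restrictReal a s.length }

/-- The position at which the defining tuple `u k` starts. -/
def blockStart (u : ℕ → List Bool) : ℕ → ℕ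
  | 0 => 0
  | k + 1 => oi u k + 1

lemma restrictReal_eq_map (a : ℕ → Bool) (n : ℕ) :
    restrictReal a n = (List.range n).map a := by
  apply List.ext_getElem <;> simp [restrictReal]

lemma length_restrictReal (a : ℕ → Bool) (n : ℕ) : (restrictReal a n).length = n := by
  simp [restrictReal]

lemma restrictReal_add (a : ℕ → Bool) (n m : ℕ) :
    restrictReal a (n + m) = restrictReal a n ++ (List.range m).map (fun j => a (n + j)) := by
  simp [restrictReal_eq_map, List.range_add, Function.comp_def]

lemma restrictReal_prefix (a : ℕ → Bool) {n m : ℕ} (h : n ≤ m) :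
    restrictReal a n <+: restrictReal a m := by
  obtain ⟨k, rfl⟩ := Nat.exists_eq_add_of_le h
  rw [restrictReal_add]
  exact List.prefix_append _ _

lemma restrictReal_eq_iff {a b : ℕ → Bool} {n : ℕ} :
    restrictReal a n = restrictReal b n ↔ ∀ i < n, a i = b i := by
  simp [restrictReal_eq_map]

lemma eq_restrictReal_of_prefix {s : List Bool} {a : ℕ → Bool} {n : ℕ}
    (h : s <+: restrictReal a n) : s = restrictReal a s.length := by
  have hl : s.length ≤ n := by simpa [length_restrictReal] using h.length_le
  refine (List.prefix_of_prefix_length_le h (restrictReal_prefix a hl) ?_).eq_of_length ?_ <;>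
    simp [length_restrictReal]

lemma branches_initialSegments_freeCube (A : Set ℕ) (c : ℕ → Bool) :
    branches (initialSegments (freeCube A c)) = freeCube A c := by
  ext a
  constructor
  · intro h i hi
    obtain ⟨b, hb, hab⟩ := h (i + 1)
    rw [length_restrictReal, restrictReal_eq_iff] at hab
    rw [hab i (Nat.lt_succ_self i), hb i hi]
  · intro h n
    exact ⟨a, h, by rw [length_restrictReal]⟩

lemma oi_zero (u : ℕ → List Bool) : oi u 0 = (u 0).length := by
  simp [oi]

lemma oi_succ (u : ℕ → List Bool) (k : ℕ) :
    oi u (k + 1) = oi u k + 1 + (u (k + 1)).length := by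
  simp only [oi, Finset.sum_range_succ]
  omega

lemma strictMono_oi (u : ℕ → List Bool) : StrictMono (oi u) :=
  strictMono_nat_of_lt_succ fun k => by rw [oi_succ]; omega

lemma blockStart_add_length (u : ℕ → List Bool) (k : ℕ) :
    blockStart u k + (u k).length = oi u k := by
  cases k with
  | zero => simp [blockStart, oi_zero]
  | succ k => rw [oi_succ, blockStart]

lemma length_silverWord (u : ℕ → List Bool) (i : ℕ → Bool) (k : ℕ) :
    (silverWord u i k).length = oi u k + 1 := by
  induction k with
  | zero => simp [silverWord, oi_zero]
  | succ k ih => rw [oi_succ, silverWord]; simp [ih]; omega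

lemma silverWord_prefix (u : ℕ → List Bool) (i : ℕ → Bool) {m n : ℕ} (h : m ≤ n) :
    silverWord u i m <+: silverWord u i n := by
  induction n, h using Nat.le_induction with
  | base => exact List.prefix_rfl
  | succ n _ ih => exact ih.trans (List.prefix_append _ _)

lemma notMem_range_of_between {n : ℕ → ℕ} (hn : StrictMono n) {k i : ℕ} (h : n k < i)
    (h' : i < n (k + 1)) : i ∉ range n := by
  rintro ⟨j, rfl⟩
  rw [hn.lt_iff_lt] at h h'
  omega

lemma notMem_range_oi {u : ℕ → List Bool} {k j : ℕ} (h : j < (u k).length) :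
    blockStart u k + j ∉ range (oi u) := by
  have hs := blockStart_add_length u k
  cases k with
  | zero =>
    rintro ⟨m, hm⟩
    have := (strictMono_oi u).monotone (Nat.zero_le m)
    omega
  | succ k =>
    rw [blockStart] at *
    exact notMem_range_of_between (strictMono_oi u) (k := k) (by omega) (by omega)

lemma silverWord_eq_restrictReal {u : ℕ → List Bool} {c a : ℕ → Bool}
    (h : ∀ k, u k = (List.range (u k).length).map fun j => c (blockStart u k + j))
    (ha : a ∈ freeCube (range (oi u)) c) (k : ℕ) :
    silverWord u (fun k => a (oi u k)) k = restrictReal a (oi u k + 1) := by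
  have key : ∀ k, u k = (List.range (u k).length).map fun j => a (blockStart u k + j) := by
    intro k
    conv_lhs => rw [h k]
    refine List.map_congr_left fun j hj => (ha _ (notMem_range_oi ?_)).symm
    exact List.mem_range.1 hj
  induction k with
  | zero =>
    rw [silverWord, restrictReal_add, oi_zero]
    congr 1
    rw [restrictReal_eq_map]
    simpa [blockStart] using key 0
  | succ k ih =>
    rw [silverWord, ih, oi_succ, Nat.add_assoc (oi u k + 1), restrictReal_add a (oi u k + 1),
      List.range_add, List.map_append]
    congr 2
    exact key (k + 1)

lemma isSilver_initialSegments {u : ℕ → List Bool} {c : ℕ → Bool}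
    (h : ∀ k, u k = (List.range (u k).length).map fun j => c (blockStart u k + j)) :
    IsSilver (initialSegments (freeCube (range (oi u)) c)) u := by
  have hinj := (strictMono_oi u).injective
  ext s
  constructor
  · rintro ⟨a, ha, hs⟩
    refine ⟨s.length, fun k => a (oi u k), ?_⟩
    rw [silverWord_eq_restrictReal h ha]
    conv_lhs => rw [hs]
    exact restrictReal_prefix a (((strictMono_oi u).le_apply).trans (Nat.le_succ _))
  · rintro ⟨n, i, hs⟩
    classical
    let a : ℕ → Bool := Function.extend (oi u) i c
    have ha : a ∈ freeCube (range (oi u)) c := fun j hj => Function.extend_apply' _ _ _ hj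
    have hi : i = fun k => a (oi u k) := funext fun k => (hinj.extend_apply _ _ _).symm
    rw [hi, silverWord_eq_restrictReal h ha] at hs
    exact ⟨a, ha, eq_restrictReal_of_prefix hs⟩

lemma exists_freeCube_of_silverTree {T : Set (List Bool)} (hT : SilverTree T) :
    ∃ A : Set ℕ, A.Infinite ∧ ∃ c, T = initialSegments (freeCube A c) := by
  obtain ⟨u, hu⟩ := hT
  let w := silverWord u fun _ => false
  let c : ℕ → Bool := fun j => (w j).getD j false
  have hw : ∀ k, (w k).length = oi u k + 1 := length_silverWord u _
  have hc : ∀ k j (hj : j < (w k).length), (w k)[j] = c j := by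
    intro k j hj
    have hj' : j < (w j).length := by
      rw [hw]; exact Nat.lt_succ_of_le (strictMono_oi u).le_apply
    have : c j = (w j)[j] := by simp [c, hj']
    rw [this]
    rcases le_total k j with hkj | hkj
    · exact (silverWord_prefix u _ hkj).getElem hj
    · exact ((silverWord_prefix u _ hkj).getElem hj').symm
  have h : ∀ k, u k = (List.range (u k).length).map fun j => c (blockStart u k + j) := by
    intro k
    apply List.ext_getElem
    · simp
    intro j hj _
    have hs := blockStart_add_length u k
    have hb : blockStart u k + j < (w k).length := by rw [hw]; omega
    simp only [List.getElem_map, List.getElem_range]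
    rw [← hc k _ hb]
    cases k with
    | zero => simp [w, silverWord, blockStart, List.getElem_append_left hj]
    | succ k =>
      have hk := hw k
      simp only [w, silverWord, blockStart] at hk ⊢
      rw [List.getElem_append_right (by omega)]
      simp [hk, List.getElem_append_left hj]
  refine ⟨range (oi u), infinite_range_of_injective (strictMono_oi u).injective, c, ?_⟩
  exact hu.trans (isSilver_initialSegments h).symm

lemma silverTree_initialSegments {A : Set ℕ} (hA : A.Infinite) (c : ℕ → Bool) :
    SilverTree (initialSegments (freeCube A c)) := by
  classical
  let n : ℕ → ℕ := Nat.nth (· ∈ A)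
  have hn : StrictMono n := Nat.nth_strictMono hA
  let st : ℕ → ℕ := fun k => Nat.rec 0 (fun k _ => n k + 1) k
  obtain ⟨u, hu'⟩ : ∃ u : ℕ → List Bool,
      ∀ k, u k = (List.range (n k - st k)).map fun j => c (st k + j) := ⟨_, fun _ => rfl⟩
  have hu : ∀ k, (u k).length = n k - st k := fun k => by simp [hu']
  have hoi : ∀ k, oi u k = n k := by
    intro k
    induction k with
    | zero => rw [oi_zero, hu]; rfl
    | succ k ih =>
      rw [oi_succ, hu, ih]
      have := hn (Nat.lt_add_one k)
      change n k + 1 + (n (k + 1) - (n k + 1)) = _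
      omega
  have hst : ∀ k, blockStart u k = st k := by
    intro k
    cases k with
    | zero => rfl
    | succ k => rw [blockStart, hoi]
  have hr : range (oi u) = A := by
    rw [funext hoi]
    exact Nat.range_nth_of_infinite hA
  refine ⟨u, ?_⟩
  have := isSilver_initialSegments (u := u) (c := c) fun k => by rw [hst, hu, hu']
  rwa [hr] at this

lemma exists_residual_continuousOn {X Y : Type*} [TopologicalSpace X] [MeasurableSpace X]
    [BorelSpace X] [TopologicalSpace Y] [SecondCountableTopology Y] [MeasurableSpace Y]
    [OpensMeasurableSpace Y] {g : X → Y} (hg : Measurable g) :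
    ∃ Z ∈ residual X, ContinuousOn g Z := by
  have hb := TopologicalSpace.isBasis_countableBasis Y
  have h : ∀ o ∈ TopologicalSpace.countableBasis Y,
      ∃ U, IsOpen U ∧ ∀ᶠ x in residual X, g x ∈ o ↔ x ∈ U := by
    intro o ho
    obtain ⟨U, hU, hgU⟩ := (hg (hb.isOpen ho).measurableSet).residualEq_isOpen
    exact ⟨U, hU, hgU.mono fun x hx => iff_of_eq hx⟩
  choose! U hU hgU using h
  refine ⟨{x | ∀ o ∈ TopologicalSpace.countableBasis Y, g x ∈ o ↔ x ∈ U o},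
    (eventually_countable_ball (TopologicalSpace.countable_countableBasis Y)).2 hgU, ?_⟩
  intro x hx
  rw [ContinuousWithinAt, hb.nhds_hasBasis.tendsto_right_iff]
  rintro o ⟨ho, hxo⟩
  filter_upwards [self_mem_nhdsWithin,
    mem_nhdsWithin_of_mem_nhds ((hU o ho).mem_nhds ((hx o ho).1 hxo))] with y hy hyU
  exact (hy o ho).2 hyU

lemma eventually_residual_dense_section {ι P Y : Type*} [Countable ι] [TopologicalSpace P]
    [TopologicalSpace Y] [SecondCountableTopology Y] [BaireSpace Y] {W : ι → Set (P × Y)}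
    (ho : ∀ j, IsOpen (W j)) (hd : ∀ j, Dense (W j)) :
    ∀ᶠ p in residual P, Dense {y | ∀ j, (p, y) ∈ W j} := by
  have hb := TopologicalSpace.isBasis_countableBasis Y
  have h : ∀ᶠ p in residual P, ∀ j, ∀ o ∈ TopologicalSpace.countableBasis Y,
      ∃ y ∈ o, (p, y) ∈ W j := by
    rw [eventually_countable_forall]
    intro j
    rw [eventually_countable_ball (TopologicalSpace.countable_countableBasis Y)]
    intro o ho'
    apply residual_of_dense_open
    · have : {p | ∃ y ∈ o, (p, y) ∈ W j} = Prod.fst '' (W j ∩ Prod.snd ⁻¹' o) := by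
        ext p; simp [and_comm]
      rw [this]
      exact isOpenMap_fst _ ((ho j).inter ((hb.isOpen ho').preimage continuous_snd))
    · rw [dense_iff_inter_open]
      rintro N hN ⟨p, hp⟩
      obtain ⟨y, hy⟩ := TopologicalSpace.nonempty_of_mem_countableBasis ho'
      obtain ⟨⟨q, z⟩, hqz, hW⟩ := dense_iff_inter_open.1 (hd j) (N ×ˢ o)
        (hN.prod (hb.isOpen ho')) ⟨(p, y), hp, hy⟩
      exact ⟨q, hqz.1, z, hqz.2, hW⟩
  filter_upwards [h] with p hp
  rw [Set.ofPred_forall]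
  refine dense_iInter_of_isOpen (fun j => (ho j).preimage (by fun_prop)) fun j => ?_
  rw [hb.dense_iff]
  intro o ho' _
  obtain ⟨y, hy, hyW⟩ := hp j o ho'
  exact ⟨y, hy, hyW⟩

lemma ContinuousOn.eq_of_mem_closure_graphOn {X Y : Type*} [TopologicalSpace X]
    [TopologicalSpace Y] [T2Space Y] {g : X → Y} {Z : Set X} (hg : ContinuousOn g Z) {x : X}
    (hx : x ∈ Z) {y : Y} (h : (x, y) ∈ closure (Z.graphOn g)) : y = g x := by
  by_contra hne
  obtain ⟨V, V', hV, hV', hyV, hgV, hdisj⟩ := t2_separation hne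
  obtain ⟨U, hU, hUV⟩ := continuousOn_iff'.1 hg V' hV'
  have hxU : x ∈ U := (hUV.subset ⟨hgV, hx⟩).1
  obtain ⟨⟨x', y'⟩, ⟨hx'U, hy'V⟩, hxy⟩ := mem_closure_iff.1 h (U ×ˢ V) (hU.prod hV) ⟨hxU, hyV⟩
  simp only [mem_graphOn] at hxy
  obtain ⟨hx'Z, rfl⟩ := hxy
  exact hdisj.le_bot ⟨hy'V, (hUV.superset ⟨hx'U, hx'Z⟩).1⟩

/-- The space of countable families of partial functions `ℕ ⇀ Bool`: in `(b, x)`, the bit `b` says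
that the value is undefined, and otherwise the value is `x`. -/
abbrev PartialFamily := ℕ → ℕ → Bool × Bool

/-- The total function which extends the partial function `p` by the values of `b`. -/
def fillIn (p : ℕ → Bool × Bool) (b : ℕ → Bool) : ℕ → Bool :=
  fun i => if (p i).1 then b i else (p i).2

/-- The sequence which agrees with `a` below `l` and with `e` from `l` on. -/
def splice {D : Type*} (l : ℕ) (a e : ℕ → D) : ℕ → D :=
  fun i => if i < l then a i else e i

lemma splice_of_lt {D : Type*} {l i : ℕ} (h : i < l) (a e : ℕ → D) : splice l a e i = a i :=
  if_pos h

lemma splice_of_le {D : Type*} {l i : ℕ} (h : l ≤ i) (a e : ℕ → D) : splice l a e i = e i :=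
  if_neg h.not_gt

lemma splice_eq {D : Type*} {l : ℕ} {a d : ℕ → D} (h : ∀ i < l, d i = a i) :
    splice l a d = d := by
  funext i
  by_cases hi : i < l
  · rw [splice_of_lt hi, h i hi]
  · exact if_neg hi

lemma continuous_fillIn : Continuous fun z : (ℕ → Bool × Bool) × (ℕ → Bool) =>
    fillIn z.1 z.2 := by
  refine continuous_pi fun i => ?_
  have h : Continuous fun t : (Bool × Bool) × Bool => if t.1.1 then t.2 else t.1.2 :=
    continuous_of_discreteTopology
  exact h.comp (f := fun z : (ℕ → Bool × Bool) × (ℕ → Bool) => (z.1 i, z.2 i)) (by fun_prop)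

lemma exists_agree_subset {D E : Type*} [TopologicalSpace D] [TopologicalSpace E]
    {N : Set ((ℕ → ℕ → D) × (ℕ → E))} (hN : IsOpen N) {p : ℕ → ℕ → D} {x : ℕ → E}
    (h : (p, x) ∈ N) :
    ∃ l, ∀ q y, (∀ k, ∀ i < l, q k i = p k i) → (∀ i < l, y i = x i) → (q, y) ∈ N := by
  by_contra! hne
  choose q y hq hy hqy using hne
  have h1 : Filter.Tendsto q Filter.atTop (nhds p) := by
    simp only [tendsto_pi_nhds]
    intro k i
    refine tendsto_const_nhds.congr' ?_
    filter_upwards [Filter.eventually_gt_atTop i] with l hl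
    exact (hq l k i hl).symm
  have h2 : Filter.Tendsto y Filter.atTop (nhds x) := by
    rw [tendsto_pi_nhds]
    intro i
    refine tendsto_const_nhds.congr' ?_
    filter_upwards [Filter.eventually_gt_atTop i] with l hl
    exact (hy l i hl).symm
  obtain ⟨l, hl⟩ := ((h1.prodMk_nhds h2).eventually (hN.mem_nhds h)).exists
  exact hqy l hl

lemma isOpen_agree {D : Type*} [TopologicalSpace D] [DiscreteTopology D] (l : ℕ) (a : ℕ → D) :
    IsOpen {d : ℕ → D | ∀ i < l, d i = a i} := by
  have : {d : ℕ → D | ∀ i < l, d i = a i} = (Set.Iio l).pi fun i => {a i} := by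
    ext; simp
  rw [this]
  exact isOpen_set_pi (Set.finite_Iio l) fun _ _ => isOpen_discrete _

lemma Dense.exists_agree {B Y : Type*} [TopologicalSpace B] [TopologicalSpace Y]
    [DiscreteTopology B] [DiscreteTopology Y] {Z : Set ((ℕ → B) × (ℕ → Y))} (hZ : Dense Z) (l : ℕ)
    (a : ℕ → B) (x : ℕ → Y) :
    ∃ d y, (∀ i < l, d i = a i) ∧ (∀ i < l, y i = x i) ∧ (d, y) ∈ Z := by
  obtain ⟨⟨d, y⟩, hdy, h⟩ := dense_iff_inter_open.1 hZ _
    ((isOpen_agree l a).prod (isOpen_agree l x)) ⟨(a, x), fun _ _ => rfl, fun _ _ => rfl⟩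
  exact ⟨d, y, hdy.1, hdy.2, h⟩

/-- The parameters `(p, x)` such that all pairs of total extensions of `p 0` and `p m` lie, together
with `x`, in `E`. -/
def fillInCore (m : ℕ) (E : Set ((ℕ → Bool) × (ℕ → Bool) × (ℕ → ℕ))) :
    Set (PartialFamily × (ℕ → ℕ)) :=
  { z | ∀ b b', (fillIn (z.1 0) b, fillIn (z.1 m) b', z.2) ∈ E }

lemma continuous_fillIn_pair (m : ℕ) : Continuous
    fun w : ((ℕ → Bool) × (ℕ → Bool)) × (PartialFamily × (ℕ → ℕ)) =>
      (fillIn (w.2.1 0) w.1.1, fillIn (w.2.1 m) w.1.2, w.2.2) := by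
  refine Continuous.prodMk ?_ (Continuous.prodMk ?_ (by fun_prop))
  · exact continuous_fillIn.comp (f := fun w : ((ℕ → Bool) × (ℕ → Bool)) ×
      (PartialFamily × (ℕ → ℕ)) => (w.2.1 0, w.1.1)) (by fun_prop)
  · exact continuous_fillIn.comp (f := fun w : ((ℕ → Bool) × (ℕ → Bool)) ×
      (PartialFamily × (ℕ → ℕ)) => (w.2.1 m, w.1.2)) (by fun_prop)

lemma isOpen_fillInCore (m : ℕ) {E : Set ((ℕ → Bool) × (ℕ → Bool) × (ℕ → ℕ))} (hE : IsOpen E) :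
    IsOpen (fillInCore m E) := by
  have hc := isClosedMap_snd_of_compactSpace (X := (ℕ → Bool) × (ℕ → Bool)) _
    ((hE.preimage (continuous_fillIn_pair m)).isClosed_compl)
  convert hc.isOpen_compl using 1
  ext z
  simp [fillInCore]

lemma fillIn_splice (l : ℕ) (p : ℕ → Bool × Bool) (e b : ℕ → Bool) :
    fillIn (splice l p fun i => (false, e i)) b = splice l (fillIn p b) e := by
  funext i
  by_cases hi : i < l <;> simp [fillIn, splice, hi]

lemma dense_fillInCore (m : ℕ) {E : Set ((ℕ → Bool) × (ℕ → Bool) × (ℕ → ℕ))} (hE : IsOpen E)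
    (hext : ∀ l a a' (x : ℕ → ℕ), ∃ (e : ℕ → ℕ → Bool) (y : ℕ → ℕ), (∀ i < l, y i = x i) ∧
      (splice l a (e 0), splice l a' (e m), y) ∈ E) :
    Dense (fillInCore m E) := by
  rw [dense_iff_inter_open]
  classical
  rintro N hN ⟨⟨p, x⟩, hpx⟩
  obtain ⟨l, hl⟩ := exists_agree_subset hN hpx
  have key : ∀ F : Finset ((ℕ → Bool) × (ℕ → Bool)), ∃ (q : PartialFamily) (y : ℕ → ℕ),
      (∀ k, ∀ i < l, q k i = p k i) ∧ (∀ k i, l ≤ i → (q k i).1 = false) ∧ (∀ i < l, y i = x i) ∧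
      ∀ c ∈ F, (fillIn (q 0) c.1, fillIn (q m) c.2, y) ∈ E := by
    intro F
    induction F using Finset.induction_on with
    | empty =>
      refine ⟨fun k => splice l (p k) fun _ => (false, false), x,
        fun k i hi => splice_of_lt hi _ _, fun k i hi => ?_, fun _ _ => rfl, by simp⟩
      simp only [splice_of_le hi]
    | insert c F _ ih =>
      obtain ⟨q, y, hq, hq', hy, hF⟩ := ih
      have hM : IsOpen {z : PartialFamily × (ℕ → ℕ) |
          ∀ c ∈ F, (fillIn (z.1 0) c.1, fillIn (z.1 m) c.2, z.2) ∈ E} := by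
        simp only [Set.ofPred_forall]
        refine isOpen_biInter_finset fun c _ => ?_
        exact (hE.preimage (continuous_fillIn_pair m)).preimage (Continuous.prodMk_right c)
      obtain ⟨r, hr⟩ := exists_agree_subset hM (p := q) (x := y) hF
      obtain ⟨e, y', hy', he⟩ :=
        hext (max l r) (fillIn (q 0) c.1) (fillIn (q m) c.2) y
      refine ⟨fun k => splice (max l r) (q k) fun i => (false, e k i), y', ?_, ?_, ?_, ?_⟩
      · intro k i hi
        simp only [splice_of_lt (lt_max_of_lt_left hi : i < max l r), hq k i hi]
      · intro k i hi
        by_cases hi' : i < max l r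
        · simp only [splice_of_lt hi', hq' k i hi]
        · simp only [splice_of_le (not_lt.1 hi')]
      · intro i hi
        rw [hy' i (lt_max_of_lt_left hi), hy i hi]
      · intro c' hc'
        rcases Finset.mem_insert.1 hc' with rfl | hc'
        · simpa only [fillIn_splice] using he
        · exact hr (fun k => splice (max l r) (q k) fun i => (false, e k i)) y'
            (fun k i hi => splice_of_lt (lt_max_of_lt_right hi) _ _)
            (fun i hi => hy' i (lt_max_of_lt_right hi)) c' hc'
  let ext : (Fin l → Bool) → ℕ → Bool := fun t i => if h : i < l then t ⟨i, h⟩ else false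
  obtain ⟨q, y, hq, hq', hy, hF⟩ :=
    key (Finset.univ.image fun t : (Fin l → Bool) × (Fin l → Bool) => (ext t.1, ext t.2))
  refine ⟨(q, y), hl q y hq hy, fun b b' => ?_⟩
  have hfill : ∀ k (b : ℕ → Bool), fillIn (q k) b = fillIn (q k) (ext fun i => b i) := by
    intro k b
    funext i
    by_cases hi : i < l
    · simp [fillIn, ext, hi]
    · simp [fillIn, hq' k i (not_lt.1 hi)]
  rw [hfill 0 b, hfill m b']
  exact hF _ (Finset.mem_image_of_mem _ (Finset.mem_univ
    ((fun i => b i, fun i => b' i) : (Fin l → Bool) × (Fin l → Bool))))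

lemma eventually_residual_undefined {A : Set ℕ} (hA : A.Infinite) (m : ℕ) :
    ∀ᶠ p : PartialFamily in residual PartialFamily, {i ∈ A | (p m i).1 = true}.Infinite := by
  have h : ∀ᶠ p : PartialFamily in residual PartialFamily,
      ∀ n, ∃ i > n, i ∈ A ∧ (p m i).1 = true := by
    rw [eventually_countable_forall]
    intro n
    apply residual_of_dense_open
    · simp only [Set.ofPred_exists, gt_iff_lt, Set.ofPred_and]
      refine isOpen_iUnion fun i => isOpen_const.inter (isOpen_const.inter ?_)
      exact (isOpen_discrete {t : Bool × Bool | t.1 = true}).preimage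
        (f := fun p : PartialFamily => p m i) (by fun_prop)
    · rw [dense_iff_inter_open]
      rintro N hN ⟨p, hp⟩
      obtain ⟨l, hl⟩ := exists_agree_subset (E := ℕ) (hN.preimage continuous_fst)
        (p := p) (x := 0) hp
      obtain ⟨i, hiA, hi⟩ := hA.exists_gt (max l n)
      refine ⟨fun k => splice l (p k) fun _ => (true, true),
        hl (fun k => splice l (p k) fun _ => (true, true)) 0 (fun k i hi => splice_of_lt hi _ _) (fun _ _ => rfl),
        i, (le_max_right l n).trans_lt hi, hiA, ?_⟩
      simp only [splice_of_le ((le_max_left l n).trans hi.le)]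
  filter_upwards [h] with p hp
  refine Set.infinite_of_not_bddAbove ?_
  rintro ⟨n, hn⟩
  obtain ⟨i, hi, hiA, hpi⟩ := hp n
  exact absurd (hn ⟨hiA, hpi⟩) (not_le.2 hi)

open Classical in
/-- The continuous retraction of Cantor space onto `freeCube A c`. -/
noncomputable def toFreeCube (A : Set ℕ) (c b : ℕ → Bool) : ℕ → Bool :=
  A.piecewise b c

lemma toFreeCube_of_mem {A : Set ℕ} {i : ℕ} (h : i ∈ A) (c b : ℕ → Bool) :
    toFreeCube A c b i = b i := by
  simp [toFreeCube, h]

lemma toFreeCube_of_notMem {A : Set ℕ} {i : ℕ} (h : i ∉ A) (c b : ℕ → Bool) :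
    toFreeCube A c b i = c i := by
  simp [toFreeCube, h]

lemma toFreeCube_mem (A : Set ℕ) (c b : ℕ → Bool) : toFreeCube A c b ∈ freeCube A c :=
  fun _ hi => toFreeCube_of_notMem hi c b

lemma toFreeCube_congr_apply {A : Set ℕ} {c b b' : ℕ → Bool} {i : ℕ} (h : b i = b' i) :
    toFreeCube A c b i = toFreeCube A c b' i := by
  by_cases hi : i ∈ A
  · rw [toFreeCube_of_mem hi, toFreeCube_of_mem hi, h]
  · rw [toFreeCube_of_notMem hi, toFreeCube_of_notMem hi]

lemma continuous_toFreeCube (A : Set ℕ) (c : ℕ → Bool) : Continuous (toFreeCube A c) := by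
  refine continuous_pi fun i => ?_
  by_cases hi : i ∈ A
  · simpa only [toFreeCube_of_mem hi] using continuous_apply i
  · simpa only [toFreeCube_of_notMem hi] using continuous_const

lemma continuous_shiftR (σ : List Bool) : Continuous (shiftR σ) := by
  refine continuous_pi fun i => ?_
  exact (continuous_of_discreteTopology (f := fun t => xor t (σ.getD i false))).comp
    (continuous_apply i)

lemma shiftR_of_length_le {σ : List Bool} {i : ℕ} (h : σ.length ≤ i) (a : ℕ → Bool) :
    shiftR σ a i = a i := by
  rw [shiftR, List.getD_eq_default _ _ h, Bool.xor_false]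

/-- The set of branches through `freeCube A c` which are determined by the partial function `p`. -/
def subCube (A : Set ℕ) (c : ℕ → Bool) (p : ℕ → Bool × Bool) : Set (ℕ → Bool) :=
  freeCube {i ∈ A | (p i).1 = true} (toFreeCube A c (fillIn p fun _ => false))

lemma toFreeCube_fillIn_eq {A : Set ℕ} {c : ℕ → Bool} {p : ℕ → Bool × Bool} {a : ℕ → Bool}
    (ha : a ∈ subCube A c p) : toFreeCube A c (fillIn p a) = a := by
  funext i
  by_cases hi : i ∈ A
  · rw [toFreeCube_of_mem hi]
    by_cases hp : (p i).1 = true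
    · simp [fillIn, hp]
    · rw [ha i fun h => hp h.2, toFreeCube_of_mem hi]
      simp [fillIn, hp]
  · rw [toFreeCube_of_notMem hi, ha i fun h => hi h.1, toFreeCube_of_notMem hi]

lemma initialSegments_subCube_subset (A : Set ℕ) (c : ℕ → Bool) (p : ℕ → Bool × Bool) :
    initialSegments (subCube A c p) ⊆ initialSegments (freeCube A c) := by
  rintro s ⟨a, ha, hs⟩
  refine ⟨a, ?_, hs⟩
  rw [← toFreeCube_fillIn_eq ha]
  exact toFreeCube_mem _ _ _

lemma continuousOn_subCube {f : (ℕ → Bool) × (ℕ → ℕ) → (ℕ → Bool)} {A : Set ℕ} {c : ℕ → Bool}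
    {p : ℕ → Bool × Bool} {Z : Set ((ℕ → Bool) × (ℕ → ℕ))} {X : Set (ℕ → ℕ)}
    (hf : ContinuousOn (fun z : (ℕ → Bool) × (ℕ → ℕ) => f (toFreeCube A c z.1, z.2)) Z)
    (hX : ∀ x ∈ X, ∀ b, (fillIn p b, x) ∈ Z) : ContinuousOn f (subCube A c p ×ˢ X) := by
  have hr : Continuous fun z : (ℕ → Bool) × (ℕ → ℕ) => (fillIn p z.1, z.2) :=
    (continuous_fillIn.comp (f := fun z : (ℕ → Bool) × (ℕ → ℕ) => (p, z.1))
      (by fun_prop)).prodMk continuous_snd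
  refine (hf.comp hr.continuousOn fun z hz => hX _ hz.2 _).congr fun z hz => ?_
  simp only [Function.comp_apply, toFreeCube_fillIn_eq hz.1]

lemma baire_restrict (y : ℕ → ℕ) (l : ℕ) :
    baire ((List.range l).map y) = {x | ∀ i < l, x i = y i} := by
  ext x
  simp [baire, Fin.forall_iff]

/-- given a countable set `𝕌 = {T₀, T₁, …}` of Silver trees and a
Borel `f : 2^ω × ω^ω → 2^ω`, there is a countable set `𝕌' = {S₀, S₁, …}` of
Silver trees with `S_n ⊆ T_n` for all `n` and `f` normalized on `S₀` for `𝕌'`. -/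
theorem stmt10 (T : ℕ → Set (List Bool)) (hT : ∀ n, SilverTree (T n))
    (f : (ℕ → Bool) × (ℕ → ℕ) → (ℕ → Bool)) (hf : Measurable f) :
    ∃ S : ℕ → Set (List Bool),
      (∀ n, SilverTree (S n)) ∧ (∀ n, S n ⊆ T n) ∧
      Normalized f (S 0) (Set.range S) := by
  choose A hA c hc using fun n => exists_freeCube_of_silverTree (hT n)
  let h : ℕ → (ℕ → Bool) → ℕ → Bool := fun m => toFreeCube (A m) (c m)
  let g : (ℕ → Bool) × (ℕ → ℕ) → (ℕ → Bool) := fun z => f (h 0 z.1, z.2)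
  have hh : ∀ m, Continuous (h m) := fun m => continuous_toFreeCube _ _
  have hg : Measurable g :=
    hf.comp (((hh 0).comp continuous_fst).prodMk continuous_snd).measurable
  obtain ⟨Z', hZ', hgZ'⟩ := exists_residual_continuousOn hg
  obtain ⟨𝒵, h𝒵o, h𝒵d, h𝒵c, h𝒵⟩ := mem_residual_iff.1 hZ'
  have : Countable 𝒵 := h𝒵c
  let Z := ⋂₀ 𝒵
  have hgZ : ContinuousOn g Z := hgZ'.mono h𝒵
  have hZd : Dense Z := dense_of_mem_residual (mem_residual_iff.2 ⟨𝒵, h𝒵o, h𝒵d, h𝒵c, subset_rfl⟩)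
  -- It suffices to find a generic parameter with the required properties.
  suffices H : ∃ (p : PartialFamily) (X : Set (ℕ → ℕ)),
      (∀ m, {i ∈ A m | (p m i).1 = true}.Infinite) ∧ IsGδ X ∧ Dense X ∧
      (∀ x ∈ X, ∀ b, (fillIn (p 0) b, x) ∈ Z) ∧
      ((∃ (v : List ℕ) (σ : List Bool), ∀ b, ∀ x ∈ baire v ∩ X,
          g (fillIn (p 0) b, x) = shiftR σ (h 0 (fillIn (p 0) b))) ∨
        ∀ b, ∀ x ∈ X, ∀ σ m b',
          g (fillIn (p 0) b, x) ≠ shiftR σ (h m (fillIn (p m) b'))) by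
    obtain ⟨p, X, hp, hXG, hXd, hXZ, hX⟩ := H
    have hgf : ∀ a ∈ subCube (A 0) (c 0) (p 0), ∀ x, g (fillIn (p 0) a, x) = f (a, x) := by
      intro a ha x
      simp only [g, h, toFreeCube_fillIn_eq ha]
    have hbr : ∀ m, branches (initialSegments (subCube (A m) (c m) (p m))) =
        subCube (A m) (c m) (p m) := fun m => branches_initialSegments_freeCube _ _
    refine ⟨fun m => initialSegments (subCube (A m) (c m) (p m)),
      fun m => silverTree_initialSegments (hp m) _,
      fun m => (initialSegments_subCube_subset _ _ _).trans (hc m).superset,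
      X, hXG, hXd, ?_, hX.imp ?_ ?_⟩
    · rw [hbr]
      exact continuousOn_subCube hgZ hXZ
    · rintro ⟨v, σ, hv⟩
      refine ⟨v, σ, fun a ha x hx => ?_⟩
      rw [hbr] at ha
      rw [← hgf a ha, hv a x hx]
      simp only [h, toFreeCube_fillIn_eq ha]
    · rintro hne a ha x hx σ _ ⟨m, rfl⟩ ⟨a', ha', haa'⟩
      rw [hbr] at ha ha'
      refine hne a x hx σ m a' ?_
      rw [hgf a ha, ← haa']
      simp only [h, toFreeCube_fillIn_eq ha']
  have hinf : ∀ᶠ p : PartialFamily in residual PartialFamily,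
      ∀ m, {i ∈ A m | (p m i).1 = true}.Infinite :=
    eventually_countable_forall.2 fun m => eventually_residual_undefined (hA m) m
  let E : 𝒵 → Set ((ℕ → Bool) × (ℕ → Bool) × (ℕ → ℕ)) := fun t => {w | (w.1, w.2.2) ∈ t.1}
  have hEo : ∀ t, IsOpen (E t) := fun t => (h𝒵o t.1 t.2).preimage (by fun_prop)
  have hEd : ∀ t, Dense (fillInCore 0 (E t)) := by
    intro t
    refine dense_fillInCore 0 (hEo t) fun l a a' x => ?_
    obtain ⟨d, y, hd, hy, hdy⟩ := (h𝒵d t.1 t.2).exists_agree l a x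
    refine ⟨fun _ => d, y, hy, ?_⟩
    simpa only [E, mem_ofPred_eq, splice_eq hd] using hdy
  have hGδ : ∀ {ι : Type} [Countable ι] (W : ι → Set (PartialFamily × (ℕ → ℕ))) (p : PartialFamily),
      (∀ j, IsOpen (W j)) → IsGδ {x | ∀ j, (p, x) ∈ W j} := by
    intro ι _ W p hW
    rw [Set.ofPred_forall]
    exact IsGδ.iInter_of_isOpen fun j => (hW j).preimage (by fun_prop)
  by_cases hcase : ∃ U : Set ((ℕ → Bool) × (ℕ → ℕ)), IsOpen U ∧ U.Nonempty ∧
      ∃ L, ∀ z ∈ U ∩ Z, ∀ i ≥ L, g z i = h 0 z.1 i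
  · obtain ⟨U, hU, hUne, L, hL⟩ := hcase
    obtain ⟨⟨b₀, y₀⟩, hzU, hzZ⟩ := hZd.inter_open_nonempty U hU hUne
    obtain ⟨V, hV, hVZ⟩ := continuousOn_iff'.1 hgZ _ (isOpen_agree L (g (b₀, y₀)))
    have hzV : (b₀, y₀) ∈ V := (hVZ.subset ⟨fun _ _ => rfl, hzZ⟩).1
    have hN : IsOpen ((fun w : PartialFamily × (ℕ → ℕ) =>
        ((fun i => (w.1 0 i).2 : ℕ → Bool), w.2)) ⁻¹' (U ∩ V)) :=
      (hU.inter hV).preimage (by fun_prop)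
    obtain ⟨l₀, hl₀⟩ := exists_agree_subset hN (p := fun _ i => (false, b₀ i)) (x := y₀) ⟨hzU, hzV⟩
    obtain ⟨l, hLl, hl⟩ : ∃ l ≥ L, ∀ b y, (∀ i < l, b i = b₀ i) → (∀ i < l, y i = y₀ i) →
        (b, y) ∈ U ∩ V :=
      ⟨max L l₀, le_max_left _ _, fun b y hb hy =>
        hl₀ (fun _ i => (false, b i)) y
          (fun k i hi => congrArg _ (hb i (lt_max_of_lt_right hi)))
          (fun i hi => hy i (lt_max_of_lt_right hi))⟩
    have hres := hinf.and (eventually_residual_dense_section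
      (fun t => isOpen_fillInCore 0 (hEo t)) hEd)
    obtain ⟨p, hp₀, hp, hXd⟩ := (dense_of_mem_residual hres).inter_open_nonempty
      ((fun p : PartialFamily => p 0) ⁻¹' {d | ∀ i < l, d i = (false, b₀ i)})
      ((isOpen_agree l fun i => (false, b₀ i)).preimage (continuous_apply 0))
      ⟨fun _ i => (false, b₀ i), fun _ _ => rfl⟩
    have hXZ : ∀ x ∈ {x | ∀ t, (p, x) ∈ fillInCore 0 (E t)}, ∀ b, (fillIn (p 0) b, x) ∈ Z :=
      fun x hx b t ht => hx ⟨t, ht⟩ b b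
    refine ⟨p, _, hp, hGδ _ p fun t => isOpen_fillInCore 0 (hEo t), hXd, hXZ, Or.inl
      ⟨(List.range l).map y₀, (List.range L).map fun i => xor (g (b₀, y₀) i) (h 0 b₀ i), ?_⟩⟩
    rintro b x ⟨hxv, hxX⟩
    rw [baire_restrict] at hxv
    have hb : ∀ i < l, fillIn (p 0) b i = b₀ i := by
      intro i hi
      simp [fillIn, show p 0 i = _ from hp₀ i hi]
    obtain ⟨hxU, hxV⟩ := hl _ x hb hxv
    have hxZ := hXZ x hxX b
    funext i
    by_cases hi : i < L
    · have h1 : g (fillIn (p 0) b, x) i = g (b₀, y₀) i := (hVZ.superset ⟨hxV, hxZ⟩).1 i hi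
      have h2 : h 0 (fillIn (p 0) b) i = h 0 b₀ i :=
        toFreeCube_congr_apply (hb i (hi.trans_le hLl))
      rw [h1, shiftR, h2]
      simp [hi, Bool.xor_left_comm (h 0 b₀ i)]
    · rw [hL _ ⟨hxU, hxZ⟩ i (not_lt.1 hi), shiftR_of_length_le (by simpa using hi)]
  · push Not at hcase
    let Γ := closure (Z.graphOn g)
    let E' : ℕ × List Bool → Set ((ℕ → Bool) × (ℕ → Bool) × (ℕ → ℕ)) :=
      fun r => {w | ((w.1, w.2.2), shiftR r.2 (h r.1 w.2.1)) ∉ Γ}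
    have hE'o : ∀ r, IsOpen (E' r) := fun r =>
      isClosed_closure.isOpen_compl.preimage ((continuous_fst.prodMk
        (continuous_snd.comp continuous_snd)).prodMk ((continuous_shiftR r.2).comp
          ((hh r.1).comp (continuous_fst.comp continuous_snd))))
    have hE'd : ∀ r, Dense (fillInCore r.1 (E' r)) := by
      rintro ⟨m, σ⟩
      refine dense_fillInCore m (hE'o _) fun l a a' x => ?_
      suffices H : ∃ d y e, (∀ i < l, d i = a i) ∧ (∀ i < l, y i = x i) ∧ (d, y) ∈ Z ∧
          (m = 0 → e = d) ∧ g (d, y) ≠ shiftR σ (h m (splice l a' e)) by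
        obtain ⟨d, y, e, hd, hy, hdy, hm, hne⟩ := H
        refine ⟨fun k => if k = 0 then d else e, y, hy, ?_⟩
        have he : (if m = 0 then d else e) = e := by
          split_ifs with hm0
          · exact (hm hm0).symm
          · rfl
        simp only [E', mem_ofPred_eq, if_true, he, splice_eq hd]
        exact fun hΓ => hne (hgZ.eq_of_mem_closure_graphOn hdy hΓ).symm
      by_cases hm : m = 0
      · subst hm
        obtain ⟨⟨d, y⟩, ⟨⟨hd, hy⟩, hdy⟩, i, hi, hne⟩ := hcase _
          ((isOpen_agree l a).prod (isOpen_agree l x)) ⟨(a, x), fun _ _ => rfl, fun _ _ => rfl⟩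
          (max l σ.length)
        refine ⟨d, y, d, hd, hy, hdy, fun _ => rfl, fun heq => hne ?_⟩
        rw [heq, shiftR_of_length_le ((le_max_right _ _).trans hi)]
        exact toFreeCube_congr_apply (splice_of_le ((le_max_left _ _).trans hi) _ _)
      · obtain ⟨d, y, hd, hy, hdy⟩ := hZd.exists_agree l a x
        obtain ⟨i, hiA, hi⟩ := (hA m).exists_gt (max l σ.length)
        refine ⟨d, y, fun j => !g (d, y) j, hd, hy, hdy, fun h0 => absurd h0 hm, fun heq => ?_⟩
        have hi' := congrFun heq i
        rw [shiftR_of_length_le ((le_max_right _ _).trans hi.le)] at hi'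
        simp only [h] at hi'
        rw [toFreeCube_of_mem hiA, splice_of_le ((le_max_left _ _).trans hi.le)] at hi'
        simp at hi'
    let W : 𝒵 ⊕ (ℕ × List Bool) → Set (PartialFamily × (ℕ → ℕ)) :=
      Sum.elim (fun t => fillInCore 0 (E t)) fun r => fillInCore r.1 (E' r)
    have hWo : ∀ j, IsOpen (W j) := by
      rintro (t | r)
      exacts [isOpen_fillInCore 0 (hEo t), isOpen_fillInCore r.1 (hE'o r)]
    have hWd : ∀ j, Dense (W j) := by
      rintro (t | r)
      exacts [hEd t, hE'd r]
    obtain ⟨p, hp, hXd⟩ := (dense_of_mem_residual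
      (hinf.and (eventually_residual_dense_section hWo hWd))).nonempty
    have hXZ : ∀ x ∈ {x | ∀ j, (p, x) ∈ W j}, ∀ b, (fillIn (p 0) b, x) ∈ Z :=
      fun x hx b t ht => hx (Sum.inl ⟨t, ht⟩) b b
    refine ⟨p, _, hp, hGδ W p hWo, hXd, hXZ, Or.inr fun b x hx σ m b' heq => ?_⟩
    refine hx (Sum.inr (m, σ)) b b' (subset_closure ?_)
    simp only [mem_graphOn]
    exact ⟨hXZ x hx b, heq⟩
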